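/- Let Λ be a connected k-graph and let q : Y → X_Λ be a topological covering map with Y connected. Then there exist a connected k-graph Ω, a covering of k-graphs p : Ω → Λ, and a homeomorphism φ : Y → X_Ω such that q = p̃ ∘ φ, where p̃ : X_Ω → X_Λ is the induced map of topological realizations. -/

import Mathlib

/-- A `k`-graph: a countable small category (objects identified with the
identity morphisms, i.e. the morphisms of degree `0`) equipped with a degree
functor `d : Λ → ℕᵏ` satisfying the unique factorization property. -/
structure KGraph (k : ℕ) where
  /-- The morphisms of the category. -/
  Mor : Type
  /-- The category is countable. -/
  countable : Countable Mor
  /-- The source (domain) of a morphism, viewed as a degree-zero morphism. -/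
  src : Mor → Mor
  /-- The range (codomain) of a morphism, viewed as a degree-zero morphism. -/
  rng : Mor → Mor
  /-- Composition `comp a b = a ∘ b`, meaningful when `src a = rng b`. -/
  comp : Mor → Mor → Mor
  /-- The degree functor. -/
  deg : Mor → Fin k → ℕ
  src_src : ∀ a, src (src a) = src a
  rng_src : ∀ a, rng (src a) = src a
  src_rng : ∀ a, src (rng a) = rng a
  rng_rng : ∀ a, rng (rng a) = rng a
  deg_src : ∀ a, deg (src a) = 0
  deg_rng : ∀ a, deg (rng a) = 0
  src_comp : ∀ a b, src a = rng b → src (comp a b) = src b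
  rng_comp : ∀ a b, src a = rng b → rng (comp a b) = rng a
  comp_assoc : ∀ a b c, src a = rng b → src b = rng c →
    comp (comp a b) c = comp a (comp b c)
  id_comp : ∀ a, comp (rng a) a = a
  comp_id : ∀ a, comp a (src a) = a
  deg_comp : ∀ a b, src a = rng b → deg (comp a b) = deg a + deg b
  /-- The unique factorization property. -/
  factor : ∀ (a : Mor) (m n : Fin k → ℕ), deg a = m + n →
    ∃! p : Mor × Mor, deg p.1 = m ∧ deg p.2 = n ∧ src p.1 = rng p.2 ∧
      comp p.1 p.2 = a

namespace KGraph

variable {k : ℕ} (Λ : KGraph k)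

/-- The segment `a(m,n)` of a morphism `a`, i.e. the (unique) middle factor of
`a = a(0,m) a(m,n) a(n, d(a))`; junk value `a` if no such factorization exists. -/
noncomputable def seg (a : Λ.Mor) (m n : Fin k → ℕ) : Λ.Mor :=
  letI := Classical.propDecidable
  if h : ∃ b : Λ.Mor, Λ.deg b = n - m ∧ ∃ x y : Λ.Mor,
      Λ.deg x = m ∧ Λ.src x = Λ.rng b ∧ Λ.src b = Λ.rng y ∧
      a = Λ.comp x (Λ.comp b y)
  then h.choose else a

/-- The points `⨆_{λ ∈ Λ} {λ} × [0, d(λ)]` of which the topological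
realization is a quotient; topologized as a disjoint union of subspaces of `ℝᵏ`. -/
def Points : Type :=
  Σ a : Λ.Mor, { t : Fin k → ℝ // ∀ i, 0 ≤ t i ∧ t i ≤ (Λ.deg a i : ℝ) }

instance : TopologicalSpace Λ.Points :=
  inferInstanceAs (TopologicalSpace
    (Σ a : Λ.Mor, { t : Fin k → ℝ // ∀ i, 0 ≤ t i ∧ t i ≤ (Λ.deg a i : ℝ) }))

/-- Coordinatewise floor `⌊t⌋` (as a vector of naturals; this is the honest
floor on the relevant region `t ≥ 0`). -/
noncomputable def fl (t : Fin k → ℝ) : Fin k → ℕ := fun i => (⌊t i⌋).toNat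

/-- Coordinatewise ceiling `⌈t⌉`. -/
noncomputable def ce (t : Fin k → ℝ) : Fin k → ℕ := fun i => (⌈t i⌉).toNat

/-- The fractional part `t - ⌊t⌋`. -/
noncomputable def frac (t : Fin k → ℝ) : Fin k → ℝ := fun i => t i - ((⌊t i⌋).toNat : ℝ)

/-- The relation `(μ,s) ∼ (ν,t) ⟺ μ(⌊s⌋,⌈s⌉) = ν(⌊t⌋,⌈t⌉)` and
`s - ⌊s⌋ = t - ⌊t⌋` defining the topological realization. -/
def ptRel : Λ.Points → Λ.Points → Prop := fun p q =>
  Λ.seg p.1 (fl p.2.1) (ce p.2.1) = Λ.seg q.1 (fl q.2.1) (ce q.2.1) ∧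
    frac p.2.1 = frac q.2.1

/-- `ptRel` is an equivalence relation. -/
def ptSetoid : Setoid Λ.Points where
  r := Λ.ptRel
  iseqv := ⟨fun _ => ⟨rfl, rfl⟩, fun h => ⟨h.1.symm, h.2.symm⟩,
    fun h h' => ⟨h.1.trans h'.1, h.2.trans h'.2⟩⟩

/-- The topological realization `X_Λ` of the `k`-graph `Λ`. -/
def Real : Type := Quotient Λ.ptSetoid

instance : TopologicalSpace Λ.Real :=
  inferInstanceAs (TopologicalSpace (Quotient Λ.ptSetoid))

/-- The class `[λ, t] ∈ X_Λ` of a pair `(λ, t)` with `0 ≤ t ≤ d(λ)`. -/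
def pt (a : Λ.Mor) (t : Fin k → ℝ) (h : ∀ i, 0 ≤ t i ∧ t i ≤ (Λ.deg a i : ℝ)) :
    Λ.Real :=
  Quotient.mk Λ.ptSetoid ⟨a, ⟨t, h⟩⟩

/-- The open cube `Q_λ = {[λ,t] : t ∈ (0, d(λ))}` of a morphism `λ` (of degree
`≤ (1,…,1)`). -/
def Qcube (lam : Λ.Mor) : Set Λ.Real :=
  { x | ∃ (t : Fin k → ℝ) (h : ∀ i, 0 ≤ t i ∧ t i ≤ (Λ.deg lam i : ℝ)),
      (∀ i, Λ.deg lam i = 1 → 0 < t i ∧ t i < 1) ∧ x = Λ.pt lam t h }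

/-- The `r`-skeleton `X_Λ^r` of the topological realization. -/
def skel' (G : KGraph k) : ℕ → Set G.Real
  | 0 => ⋃ v ∈ { v : G.Mor | G.deg v = 0 }, G.Qcube v
  | (r+1) => skel' G r ∪
      ⋃ lam ∈ { lam : G.Mor | G.deg lam ≤ 1 ∧ ∑ i, G.deg lam i = r + 1 },
        G.Qcube lam

/-- The `r`-skeleton (wrapper). -/
def skel (r : ℕ) : Set Λ.Real := skel' Λ r

/-- A `k`-graph is connected if any two vertices are joined by an undirected
path of morphisms. -/
def Connected : Prop :=
  ∀ u v : Λ.Mor, Λ.deg u = 0 → Λ.deg v = 0 →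
    Relation.ReflTransGen (fun x y => ∃ e : Λ.Mor,
      (Λ.src e = x ∧ Λ.rng e = y) ∨ (Λ.src e = y ∧ Λ.rng e = x)) u v

end KGraph

/-- A morphism of `k`-graphs: a degree-preserving functor. -/
@[ext]
structure KGraphHom {k : ℕ} (Λ Γ : KGraph k) where
  toFun : Λ.Mor → Γ.Mor
  map_src : ∀ a, toFun (Λ.src a) = Γ.src (toFun a)
  map_rng : ∀ a, toFun (Λ.rng a) = Γ.rng (toFun a)
  map_comp : ∀ a b, Λ.src a = Λ.rng b →
    toFun (Λ.comp a b) = Γ.comp (toFun a) (toFun b)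
  map_deg : ∀ a, Γ.deg (toFun a) = Λ.deg a

namespace KGraphHom

variable {k : ℕ} {Λ Γ Θ : KGraph k}

/-- The identity `k`-graph morphism. -/
def id (Λ : KGraph k) : KGraphHom Λ Λ :=
  ⟨fun a => a, fun _ => rfl, fun _ => rfl, fun _ _ _ => rfl, fun _ => rfl⟩

/-- Composition of `k`-graph morphisms. -/
def comp (ψ : KGraphHom Γ Θ) (φ : KGraphHom Λ Γ) : KGraphHom Λ Θ where
  toFun := ψ.toFun ∘ φ.toFun
  map_src a := by simp [Function.comp, φ.map_src, ψ.map_src]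
  map_rng a := by simp [Function.comp, φ.map_rng, ψ.map_rng]
  map_comp a b h := by
    simp only [Function.comp]
    rw [φ.map_comp a b h, ψ.map_comp _ _ (by rw [← φ.map_src, ← φ.map_rng, h])]
  map_deg a := by simp [Function.comp, φ.map_deg, ψ.map_deg]

/-- The induced map on points `(λ, t) ↦ (φ(λ), t)`. -/
def pointMap (φ : KGraphHom Λ Γ) : Λ.Points → Γ.Points :=
  fun p => ⟨φ.toFun p.1, ⟨p.2.1, fun i => by rw [φ.map_deg]; exact p.2.2 i⟩⟩

/-- The induced map `φ̃ : X_Λ → X_Γ` on topological realizations,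
`φ̃([λ,t]) = [φ(λ), t]` (defined via choice of representatives). -/
noncomputable def real (φ : KGraphHom Λ Γ) : Λ.Real → Γ.Real :=
  fun x => Quotient.mk Γ.ptSetoid (φ.pointMap (Quotient.out x))

end KGraphHom

/-- A covering of `k`-graphs: a surjective degree-preserving functor
`p : Ω → Λ` mapping `Ωv` bijectively onto `Λp(v)` and `vΩ` bijectively onto
`p(v)Λ` for every vertex `v` of `Ω`. -/
def KGraphHom.IsCovering {k : ℕ} {Ω Λ : KGraph k} (p : KGraphHom Ω Λ) : Prop :=
  Function.Surjective p.toFun ∧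
    ∀ v : Ω.Mor, Ω.deg v = 0 →
      Set.BijOn p.toFun { a | Ω.src a = v } { b | Λ.src b = p.toFun v } ∧
      Set.BijOn p.toFun { a | Ω.rng a = v } { b | Λ.rng b = p.toFun v }

namespace KGraph

variable {k : ℕ}

section Boxes

/-- The real vector underlying a degree. -/
def vec (n : Fin k → ℕ) : Fin k → ℝ := fun i => (n i : ℝ)

/-- The coordinatewise retraction of `ℝᵏ` onto the box `[0, n]`. -/
noncomputable def clamp (n : Fin k → ℕ) (t : Fin k → ℝ) : Fin k → ℝ :=
  fun i => max 0 (min (t i) (n i))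

theorem continuous_clamp (n : Fin k → ℕ) : Continuous (clamp n) := by
  unfold clamp
  fun_prop

theorem clamp_mem (n : Fin k → ℕ) (t : Fin k → ℝ) (i : Fin k) :
    0 ≤ clamp n t i ∧ clamp n t i ≤ (n i : ℝ) :=
  ⟨le_max_left _ _, max_le (Nat.cast_nonneg _) (min_le_right _ _)⟩

theorem clamp_eq_self {n : Fin k → ℕ} {t : Fin k → ℝ} (h : ∀ i, 0 ≤ t i ∧ t i ≤ (n i : ℝ)) :
    clamp n t = t := by
  funext i
  simp [clamp, h i]

@[simp]
theorem vec_zero : vec (0 : Fin k → ℕ) = 0 := by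
  funext i
  simp [vec]

theorem vec_add (m n : Fin k → ℕ) : vec (m + n) = vec m + vec n := by
  funext i
  simp [vec]

@[simp]
theorem clamp_apply_zero (n : Fin k → ℕ) : clamp n 0 = 0 :=
  clamp_eq_self fun i => by simp

@[simp]
theorem clamp_zero (t : Fin k → ℝ) : clamp 0 t = 0 := by
  funext i
  simp [clamp]

@[simp]
theorem clamp_vec (n : Fin k → ℕ) : clamp n (vec n) = vec n :=
  clamp_eq_self fun i => by simp [vec]

theorem fl_vec_add (m : Fin k → ℕ) {t : Fin k → ℝ} (h : ∀ i, 0 ≤ t i) :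
    fl (vec m + t) = m + fl t := by
  funext i
  have : 0 ≤ ⌊t i⌋ := Int.floor_nonneg.2 (h i)
  simp only [fl, vec, Pi.add_apply, Int.floor_natCast_add]
  omega

theorem ce_vec_add (m : Fin k → ℕ) {t : Fin k → ℝ} (h : ∀ i, 0 ≤ t i) :
    ce (vec m + t) = m + ce t := by
  funext i
  have : 0 ≤ ⌈t i⌉ := Int.ceil_nonneg (h i)
  simp only [ce, vec, Pi.add_apply, Int.ceil_natCast_add]
  omega

theorem vec_fl_add_frac (t : Fin k → ℝ) : vec (fl t) + frac t = t := by
  funext i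
  simp [vec, fl, frac]

theorem frac_vec_add (m : Fin k → ℕ) {t : Fin k → ℝ} (h : ∀ i, 0 ≤ t i) :
    frac (vec m + t) = frac t := by
  have h₁ := vec_fl_add_frac (vec m + t)
  rw [fl_vec_add m h, vec_add, add_assoc] at h₁
  exact add_left_cancel ((add_left_cancel h₁).trans (vec_fl_add_frac t).symm)

theorem fl_le_ce (t : Fin k → ℝ) : fl t ≤ ce t :=
  fun i => Int.toNat_le_toNat (Int.floor_le_ceil (t i))

theorem ce_le {n : Fin k → ℕ} {t : Fin k → ℝ} (h : ∀ i, t i ≤ (n i : ℝ)) : ce t ≤ n := by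
  intro i
  have : ⌈t i⌉ ≤ (n i : ℤ) := Int.ceil_le.2 (by exact_mod_cast h i)
  simp only [ce]
  omega

theorem frac_mem {t : Fin k → ℝ} (h : ∀ i, 0 ≤ t i) (i : Fin k) :
    0 ≤ frac t i ∧ frac t i ≤ ((ce t - fl t) i : ℕ) := by
  have hf : 0 ≤ ⌊t i⌋ := Int.floor_nonneg.2 (h i)
  have hc : 0 ≤ ⌈t i⌉ := Int.ceil_nonneg (h i)
  have hf' : ((⌊t i⌋.toNat : ℕ) : ℝ) = (⌊t i⌋ : ℝ) := by exact_mod_cast Int.toNat_of_nonneg hf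
  have hc' : ((⌈t i⌉.toNat : ℕ) : ℝ) = (⌈t i⌉ : ℝ) := by exact_mod_cast Int.toNat_of_nonneg hc
  have hle : ⌊t i⌋.toNat ≤ ⌈t i⌉.toNat := fl_le_ce t i
  simp only [frac, fl, ce, Pi.sub_apply]
  rw [Nat.cast_sub hle, hf', hc']
  exact ⟨sub_nonneg.2 (Int.floor_le _), sub_le_sub_right (Int.le_ceil _) _⟩

end Boxes

section Segments

variable (Λ : KGraph k)

theorem comp_left_cancel {a b a' b' : Λ.Mor} (h : Λ.src a = Λ.rng b) (h' : Λ.src a' = Λ.rng b')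
    (hd : Λ.deg a = Λ.deg a') (e : Λ.comp a b = Λ.comp a' b') : a = a' ∧ b = b' := by
  have hdeg : Λ.deg b = Λ.deg b' := by
    have := congrArg Λ.deg e
    rw [Λ.deg_comp _ _ h, Λ.deg_comp _ _ h', hd] at this
    exact add_left_cancel this
  have := (Λ.factor (Λ.comp a b) _ _ (Λ.deg_comp _ _ h)).unique
    (y₁ := (a, b)) (y₂ := (a', b')) ⟨rfl, rfl, h, rfl⟩ ⟨hd.symm, hdeg.symm, h', e.symm⟩
  exact ⟨congrArg Prod.fst this, congrArg Prod.snd this⟩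

theorem rng_eq_self {a : Λ.Mor} (h : Λ.deg a = 0) : Λ.rng a = a :=
  (Λ.comp_left_cancel (Λ.src_rng a) (Λ.rng_src a).symm
    (by rw [h, Λ.deg_rng]) ((Λ.id_comp a).trans (Λ.comp_id a).symm)).1

theorem src_eq_self {a : Λ.Mor} (h : Λ.deg a = 0) : Λ.src a = a := by
  rw [← Λ.rng_eq_self h, Λ.src_rng]

theorem exists_factor (a : Λ.Mor) {m : Fin k → ℕ} (h : m ≤ Λ.deg a) :
    ∃ x y, Λ.deg x = m ∧ Λ.deg y = Λ.deg a - m ∧ Λ.src x = Λ.rng y ∧ a = Λ.comp x y := by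
  obtain ⟨⟨x, y⟩, ⟨hx, hy, hs, e⟩, -⟩ := Λ.factor a m (Λ.deg a - m) (add_tsub_cancel_of_le h).symm
  exact ⟨x, y, hx, hy, hs, e.symm⟩

theorem exists_middle_factor (a : Λ.Mor) {m n : Fin k → ℕ} (hmn : m ≤ n) (h : n ≤ Λ.deg a) :
    ∃ b, Λ.deg b = n - m ∧ ∃ x y, Λ.deg x = m ∧ Λ.src x = Λ.rng b ∧ Λ.src b = Λ.rng y ∧
      a = Λ.comp x (Λ.comp b y) := by
  obtain ⟨x, z, hx, hz, hs, rfl⟩ := Λ.exists_factor a (hmn.trans h)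
  obtain ⟨b, y, hb, -, hs', rfl⟩ := Λ.exists_factor z (m := n - m)
    (by rw [hz]; exact tsub_le_tsub_right h m)
  exact ⟨b, hb, x, y, hx, by rw [hs, Λ.rng_comp _ _ hs'], hs', rfl⟩

theorem seg_comp {x b y : Λ.Mor} {n : Fin k → ℕ} (h : Λ.src x = Λ.rng b)
    (h' : Λ.src b = Λ.rng y) (hn : Λ.deg b = n - Λ.deg x) :
    Λ.seg (Λ.comp x (Λ.comp b y)) (Λ.deg x) n = b := by
  have H : ∃ c : Λ.Mor, Λ.deg c = n - Λ.deg x ∧ ∃ u v : Λ.Mor,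
      Λ.deg u = Λ.deg x ∧ Λ.src u = Λ.rng c ∧ Λ.src c = Λ.rng v ∧
      Λ.comp x (Λ.comp b y) = Λ.comp u (Λ.comp c v) := ⟨b, hn, x, y, rfl, h, h', rfl⟩
  rw [seg, dif_pos H]
  obtain ⟨hc, u, v, hu, huc, hcv, e⟩ := H.choose_spec
  have e₂ := (Λ.comp_left_cancel (by rw [h, Λ.rng_comp _ _ h']) (by rw [huc, Λ.rng_comp _ _ hcv])
    hu.symm e).2
  exact (Λ.comp_left_cancel h' hcv (hn.trans hc.symm) e₂).1.symm

theorem exists_seg_factor (a : Λ.Mor) {m n : Fin k → ℕ} (hmn : m ≤ n) (h : n ≤ Λ.deg a) :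
    Λ.deg (Λ.seg a m n) = n - m ∧ ∃ x y, Λ.deg x = m ∧ Λ.src x = Λ.rng (Λ.seg a m n) ∧
      Λ.src (Λ.seg a m n) = Λ.rng y ∧ a = Λ.comp x (Λ.comp (Λ.seg a m n) y) := by
  obtain ⟨b, hb, x, y, rfl, hs, hs', rfl⟩ := Λ.exists_middle_factor a hmn h
  rw [Λ.seg_comp hs hs' hb]
  exact ⟨hb, x, y, rfl, hs, hs', rfl⟩

theorem seg_middle {x b y : Λ.Mor} {m n : Fin k → ℕ} (h : Λ.src x = Λ.rng b)
    (h' : Λ.src b = Λ.rng y) (hmn : m ≤ n) (hn : n ≤ Λ.deg b) :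
    Λ.seg (Λ.comp x (Λ.comp b y)) (Λ.deg x + m) (Λ.deg x + n) = Λ.seg b m n := by
  obtain ⟨c, hc, u, v, rfl, hs, hs', rfl⟩ := Λ.exists_middle_factor b hmn hn
  have huc : Λ.src u = Λ.rng (Λ.comp c v) := by rw [Λ.rng_comp _ _ hs', hs]
  rw [Λ.rng_comp _ _ huc] at h
  rw [Λ.src_comp _ _ huc, Λ.src_comp _ _ hs'] at h'
  have hcvy : Λ.src (Λ.comp c v) = Λ.rng y := by rw [Λ.src_comp _ _ hs', h']
  have hcvy' : Λ.src c = Λ.rng (Λ.comp v y) := by rw [Λ.rng_comp _ _ h', hs']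
  have e : Λ.comp x (Λ.comp (Λ.comp u (Λ.comp c v)) y) =
      Λ.comp (Λ.comp x u) (Λ.comp c (Λ.comp v y)) := by
    rw [Λ.comp_assoc u _ y huc hcvy, Λ.comp_assoc c v y hs' h', Λ.comp_assoc x u _ h]
    rw [hs, Λ.rng_comp _ _ hcvy']
  rw [e, Λ.seg_comp hs hs' hc, ← Λ.deg_comp _ _ h]
  refine Λ.seg_comp ?_ hcvy' ?_
  · rw [Λ.src_comp _ _ h, hs]
  · rw [Λ.deg_comp _ _ h, hc, add_tsub_add_eq_tsub_left]

theorem pt_middle {x b y : Λ.Mor} (h : Λ.src x = Λ.rng b) (h' : Λ.src b = Λ.rng y)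
    {t : Fin k → ℝ} (ht : ∀ i, 0 ≤ t i ∧ t i ≤ (Λ.deg b i : ℝ))
    (ht' : ∀ i, 0 ≤ (vec (Λ.deg x) + t) i ∧
      (vec (Λ.deg x) + t) i ≤ (Λ.deg (Λ.comp x (Λ.comp b y)) i : ℝ)) :
    Λ.pt (Λ.comp x (Λ.comp b y)) (vec (Λ.deg x) + t) ht' = Λ.pt b t ht := by
  refine Quotient.sound (s := Λ.ptSetoid) ⟨?_, frac_vec_add _ fun i => (ht i).1⟩
  simp only [fl_vec_add _ fun i => (ht i).1, ce_vec_add _ fun i => (ht i).1]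
  exact Λ.seg_middle h h' (fl_le_ce t) (ce_le fun i => (ht i).2)

/-- The characteristic map `t ↦ [a, t]` of the box `[0, d(a)]`, extended to `ℝᵏ` by clamping. -/
noncomputable def boxMap (a : Λ.Mor) : C(Fin k → ℝ, Λ.Real) where
  toFun t := Λ.pt a (clamp (Λ.deg a) t) (clamp_mem _ t)
  continuous_toFun := by
    refine (continuous_quotient_mk' (s := Λ.ptSetoid)).comp ?_
    exact (continuous_sigmaMk (σ := fun a : Λ.Mor =>
      { t : Fin k → ℝ // ∀ i, 0 ≤ t i ∧ t i ≤ (Λ.deg a i : ℝ) })).comp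
        ((continuous_clamp _).subtype_mk _)

theorem boxMap_eq_pt {a : Λ.Mor} {t : Fin k → ℝ} (h : ∀ i, 0 ≤ t i ∧ t i ≤ (Λ.deg a i : ℝ)) :
    Λ.boxMap a t = Λ.pt a t h := by
  change Λ.pt a (clamp (Λ.deg a) t) _ = _
  simp only [clamp_eq_self h]

theorem boxMap_clamp (a : Λ.Mor) (t : Fin k → ℝ) :
    Λ.boxMap a (clamp (Λ.deg a) t) = Λ.boxMap a t :=
  Λ.boxMap_eq_pt (clamp_mem _ t)

theorem boxMap_middle {x b y : Λ.Mor} (h : Λ.src x = Λ.rng b) (h' : Λ.src b = Λ.rng y)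
    (t : Fin k → ℝ) :
    Λ.boxMap (Λ.comp x (Λ.comp b y)) (vec (Λ.deg x) + clamp (Λ.deg b) t) = Λ.boxMap b t := by
  have ht := clamp_mem (Λ.deg b) t
  rw [Λ.boxMap_eq_pt, Λ.pt_middle h h' ht]
  · rfl
  · intro i
    rw [Λ.deg_comp _ _ (by rw [Λ.rng_comp _ _ h', h]), Λ.deg_comp _ _ h']
    simp only [vec, Pi.add_apply, Nat.cast_add]
    have := ht i
    constructor
    · exact add_nonneg (Nat.cast_nonneg _) this.1
    · linarith [this.2, Nat.cast_nonneg (α := ℝ) (Λ.deg y i)]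

theorem boxMap_comp_left {a b : Λ.Mor} (h : Λ.src a = Λ.rng b) (t : Fin k → ℝ) :
    Λ.boxMap (Λ.comp a b) (clamp (Λ.deg a) t) = Λ.boxMap a t := by
  have := Λ.boxMap_middle (Λ.src_rng a) h t
  rwa [← Λ.rng_comp a b h, Λ.id_comp, Λ.deg_rng, vec_zero, zero_add] at this

theorem boxMap_comp_right {a b : Λ.Mor} (h : Λ.src a = Λ.rng b) (t : Fin k → ℝ) :
    Λ.boxMap (Λ.comp a b) (vec (Λ.deg a) + clamp (Λ.deg b) t) = Λ.boxMap b t := by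
  have := Λ.boxMap_middle h (Λ.rng_src b).symm t
  rwa [Λ.comp_id] at this

theorem boxMap_rng (a : Λ.Mor) (t : Fin k → ℝ) : Λ.boxMap (Λ.rng a) t = Λ.boxMap a 0 := by
  have := Λ.boxMap_comp_left (Λ.src_rng a) t
  rwa [Λ.id_comp, Λ.deg_rng, clamp_zero, eq_comm] at this

theorem boxMap_src (a : Λ.Mor) (t : Fin k → ℝ) :
    Λ.boxMap (Λ.src a) t = Λ.boxMap a (vec (Λ.deg a)) := by
  have := Λ.boxMap_comp_right (Λ.rng_src a).symm t
  rwa [Λ.comp_id, Λ.deg_src, clamp_zero, add_zero, eq_comm] at this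

theorem boxMap_eq_iff {a b : Λ.Mor} {s t : Fin k → ℝ}
    (hs : ∀ i, 0 ≤ s i ∧ s i ≤ (Λ.deg a i : ℝ)) (ht : ∀ i, 0 ≤ t i ∧ t i ≤ (Λ.deg b i : ℝ)) :
    Λ.boxMap a s = Λ.boxMap b t ↔
      Λ.seg a (fl s) (ce s) = Λ.seg b (fl t) (ce t) ∧ frac s = frac t := by
  rw [Λ.boxMap_eq_pt hs, Λ.boxMap_eq_pt ht]
  exact Quotient.eq (r := Λ.ptSetoid)

theorem eq_of_boxMap_eq {a b : Λ.Mor} (ha : Λ.deg a = 0) (hb : Λ.deg b = 0)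
    (e : Λ.boxMap a 0 = Λ.boxMap b 0) : a = b := by
  have seg_self : ∀ {c : Λ.Mor}, Λ.deg c = 0 → Λ.seg c 0 0 = c := by
    intro c hc
    have h : Λ.src c = Λ.rng c := by rw [Λ.src_eq_self hc, Λ.rng_eq_self hc]
    have hcc : Λ.comp c c = c := by
      nth_rewrite 2 [← Λ.src_eq_self hc]
      exact Λ.comp_id c
    have := Λ.seg_comp h h (n := 0) (by rw [hc, tsub_zero])
    rwa [hcc, hcc, hc] at this
  have hfl : fl (0 : Fin k → ℝ) = 0 := by funext i; simp [fl]
  have hce : ce (0 : Fin k → ℝ) = 0 := by funext i; simp [ce]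
  have := ((Λ.boxMap_eq_iff (by simp) (by simp)).1 e).1
  rwa [hfl, hce, seg_self ha, seg_self hb] at this

theorem exists_boxMap_eq (z : Λ.Real) : ∃ (a : Λ.Mor) (t : Fin k → ℝ),
    (∀ i, 0 ≤ t i ∧ t i ≤ (Λ.deg a i : ℝ)) ∧ Λ.boxMap a t = z := by
  induction z using Quotient.inductionOn with
  | h p => exact ⟨p.1, p.2.1, p.2.2, Λ.boxMap_eq_pt p.2.2⟩

theorem isOpen_of_isOpen_preimage_boxMap {U : Set Λ.Real}
    (h : ∀ a, IsOpen (Λ.boxMap a ⁻¹' U)) : IsOpen U := by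
  refine (isOpen_coinduced (f := Quotient.mk Λ.ptSetoid)).2 (isOpen_sigma_iff.2 fun a => ?_)
  convert (h a).preimage continuous_subtype_val using 1
  ext t
  simp only [Set.mem_preimage, Λ.boxMap_eq_pt t.2]
  rfl

end Segments

section Lifts

variable (Λ : KGraph k) {Y : Type} [TopologicalSpace Y]

/-- A morphism of `Λ` together with a lift through `q` of its characteristic map. -/
@[ext]
structure BoxLift (q : Y → Λ.Real) where
  /-- The underlying morphism. -/
  mor : Λ.Mor
  /-- The lift of the characteristic map of `mor`. -/
  map : C(Fin k → ℝ, Y)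
  apply_map : ∀ t, q (map t) = Λ.boxMap mor t

namespace BoxLift

variable {Λ} {q : Y → Λ.Real}

theorem ext_of_apply (hq : IsCoveringMap q) {p r : Λ.BoxLift q} (h : p.mor = r.mor)
    (t : Fin k → ℝ) (e : p.map t = r.map t) : p = r := by
  refine BoxLift.ext h (DFunLike.coe_injective ?_)
  refine hq.eq_of_comp_eq p.map.continuous r.map.continuous (funext fun s => ?_) t e
  simp only [Function.comp_apply, p.apply_map, r.apply_map, h]

theorem exists_apply_eq (hq : IsCoveringMap q) (a : Λ.Mor) (t : Fin k → ℝ) (y : Y)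
    (e : q y = Λ.boxMap a t) : ∃ p : Λ.BoxLift q, p.mor = a ∧ p.map t = y := by
  obtain ⟨f, ⟨hf, hqf⟩, -⟩ := hq.existsUnique_continuousMap_lifts (Λ.boxMap a) t y e
  exact ⟨⟨a, f, congrFun hqf⟩, rfl, hf⟩

/-- The restriction of a lift to a factor of the underlying morphism. -/
noncomputable def middle (p : Λ.BoxLift q) {x b y : Λ.Mor} (e : p.mor = Λ.comp x (Λ.comp b y))
    (h : Λ.src x = Λ.rng b) (h' : Λ.src b = Λ.rng y) : Λ.BoxLift q where
  mor := b
  map := p.map.comp ⟨fun t => vec (Λ.deg x) + clamp (Λ.deg b) t,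
    continuous_const.add (continuous_clamp _)⟩
  apply_map t := by
    simp only [ContinuousMap.comp_apply, ContinuousMap.coe_mk, p.apply_map, e,
      Λ.boxMap_middle h h']

theorem map_clamp (hq : IsCoveringMap q) (p : Λ.BoxLift q) (t : Fin k → ℝ) :
    p.map (clamp (Λ.deg p.mor) t) = p.map t := by
  let r : Λ.BoxLift q := ⟨p.mor, p.map.comp ⟨clamp (Λ.deg p.mor), continuous_clamp _⟩,
    fun t => by
      simp only [ContinuousMap.comp_apply, ContinuousMap.coe_mk, p.apply_map, Λ.boxMap_clamp]⟩
  have hr : r = p := ext_of_apply hq rfl 0 (by simp [r])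
  exact congrArg (fun p : Λ.BoxLift q => p.map t) hr

/-- The source vertex of a lift. -/
noncomputable def src (p : Λ.BoxLift q) : Λ.BoxLift q where
  mor := Λ.src p.mor
  map := ContinuousMap.const _ (p.map (vec (Λ.deg p.mor)))
  apply_map t := by rw [ContinuousMap.const_apply, p.apply_map, Λ.boxMap_src]

/-- The range vertex of a lift. -/
noncomputable def rng (p : Λ.BoxLift q) : Λ.BoxLift q where
  mor := Λ.rng p.mor
  map := ContinuousMap.const _ (p.map 0)
  apply_map t := by rw [ContinuousMap.const_apply, p.apply_map, Λ.boxMap_rng]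

theorem src_eq_rng_iff {p r : Λ.BoxLift q} : p.src = r.rng ↔
    Λ.src p.mor = Λ.rng r.mor ∧ p.map (vec (Λ.deg p.mor)) = r.map 0 := by
  constructor
  · intro h
    exact ⟨congrArg mor h, congrArg (fun p : Λ.BoxLift q => p.map 0) h⟩
  · rintro ⟨h, h'⟩
    refine BoxLift.ext h ?_
    simp only [src, rng, h']

theorem exists_comp (hq : IsCoveringMap q) (p r : Λ.BoxLift q)
    (h : Λ.src p.mor = Λ.rng r.mor) :
    ∃ s : Λ.BoxLift q, s.mor = Λ.comp p.mor r.mor ∧ s.map 0 = p.map 0 := by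
  refine exists_apply_eq hq _ _ _ ?_
  have := Λ.boxMap_comp_left h 0
  rw [clamp_apply_zero] at this
  rw [p.apply_map, this]

open Classical in
/-- The composite of two lifts, with junk value `p` if the morphisms are not composable. -/
noncomputable def comp (hq : IsCoveringMap q) (p r : Λ.BoxLift q) : Λ.BoxLift q :=
  if h : Λ.src p.mor = Λ.rng r.mor then (exists_comp hq p r h).choose else p

theorem comp_mor (hq : IsCoveringMap q) {p r : Λ.BoxLift q} (h : p.src = r.rng) :
    (comp hq p r).mor = Λ.comp p.mor r.mor := by
  rw [src_eq_rng_iff] at h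
  rw [comp, dif_pos h.1]
  exact (exists_comp hq p r h.1).choose_spec.1

theorem comp_map_zero (hq : IsCoveringMap q) (p r : Λ.BoxLift q) :
    (comp hq p r).map 0 = p.map 0 := by
  rw [comp]
  split_ifs with h
  · exact (exists_comp hq p r h).choose_spec.2
  · rfl

theorem comp_map_left (hq : IsCoveringMap q) {p r : Λ.BoxLift q} (h : p.src = r.rng)
    (t : Fin k → ℝ) : (comp hq p r).map (clamp (Λ.deg p.mor) t) = p.map t := by
  have hm := (src_eq_rng_iff.1 h).1
  let s := (comp hq p r).middle (x := Λ.rng p.mor) (b := p.mor) (y := r.mor)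
    (by rw [comp_mor hq h, ← Λ.rng_comp _ _ hm, Λ.id_comp]) (Λ.src_rng _) hm
  have hs : s = p := ext_of_apply hq rfl 0 (by
    simp [s, middle, Λ.deg_rng, comp_map_zero])
  have := congrArg (fun p : Λ.BoxLift q => p.map t) hs
  simpa [s, middle, Λ.deg_rng] using this

theorem comp_map_right (hq : IsCoveringMap q) {p r : Λ.BoxLift q} (h : p.src = r.rng)
    (t : Fin k → ℝ) :
    (comp hq p r).map (vec (Λ.deg p.mor) + clamp (Λ.deg r.mor) t) = r.map t := by
  obtain ⟨hm, he⟩ := src_eq_rng_iff.1 h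
  let s := (comp hq p r).middle (x := p.mor) (b := r.mor) (y := Λ.src r.mor)
    (by rw [comp_mor hq h, Λ.comp_id]) hm (Λ.rng_src _).symm
  have hs : s = r := ext_of_apply hq rfl 0 (by
    have := comp_map_left hq h (vec (Λ.deg p.mor))
    rw [clamp_vec, he] at this
    simpa [s, middle] using this)
  exact congrArg (fun p : Λ.BoxLift q => p.map t) hs

theorem exists_seg (p : Λ.BoxLift q) {s : Fin k → ℝ}
    (hs : ∀ i, 0 ≤ s i ∧ s i ≤ (Λ.deg p.mor i : ℝ)) :
    ∃ r : Λ.BoxLift q, r.mor = Λ.seg p.mor (fl s) (ce s) ∧ r.map 0 = p.map (vec (fl s)) ∧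
      r.map (frac s) = p.map s := by
  obtain ⟨hd, x, y, hx, hxb, hby, e⟩ := Λ.exists_seg_factor p.mor (fl_le_ce s)
    (ce_le fun i => (hs i).2)
  refine ⟨p.middle e hxb hby, rfl, by simp [middle, hx], ?_⟩
  simp only [middle, ContinuousMap.comp_apply, ContinuousMap.coe_mk, hx]
  rw [clamp_eq_self (by rw [hd]; exact frac_mem fun i => (hs i).1), vec_fl_add_frac]

theorem map_fl_eq (hq : IsCoveringMap q) {p r : Λ.BoxLift q} {s t : Fin k → ℝ}
    (hs : ∀ i, 0 ≤ s i ∧ s i ≤ (Λ.deg p.mor i : ℝ))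
    (ht : ∀ i, 0 ≤ t i ∧ t i ≤ (Λ.deg r.mor i : ℝ)) (e : p.map s = r.map t) :
    p.map (vec (fl s)) = r.map (vec (fl t)) := by
  have hm := (Λ.boxMap_eq_iff hs ht).1 (by rw [← p.apply_map, ← r.apply_map, e])
  obtain ⟨p', hp, hp₀, hp₁⟩ := p.exists_seg hs
  obtain ⟨r', hr, hr₀, hr₁⟩ := r.exists_seg ht
  have : p' = r' := ext_of_apply hq (by rw [hp, hr, hm.1]) (frac s) (by rw [hp₁, hm.2, hr₁, e])
  rw [← hp₀, ← hr₀, this]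

theorem isOpen_of_isOpen_preimage_map (hq : IsCoveringMap q) {U : Set Y}
    (h : ∀ p : Λ.BoxLift q, IsOpen (p.map ⁻¹' U)) : IsOpen U := by
  refine isOpen_iff_forall_mem_open.2 fun y hy => ?_
  obtain ⟨S, hS, hyS, hinj⟩ := hq.isLocalHomeomorph.isLocallyInjective y
  have hopen : IsOpen (q '' (U ∩ S)) := by
    refine Λ.isOpen_of_isOpen_preimage_boxMap fun a => isOpen_iff_forall_mem_open.2 ?_
    rintro t ⟨u, hu, hut⟩
    obtain ⟨p, rfl, rfl⟩ := exists_apply_eq hq a t u hut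
    refine ⟨p.map ⁻¹' (U ∩ S), fun s hs => ⟨p.map s, hs, p.apply_map s⟩, ?_, hu⟩
    exact (h p).inter (hS.preimage p.map.continuous)
  refine ⟨S ∩ q ⁻¹' (q '' (U ∩ S)), ?_, hS.inter (hopen.preimage hq.continuous),
    hyS, y, ⟨hy, hyS⟩, rfl⟩
  rintro z ⟨hz, w, hw, hwz⟩
  exact hinj hw.2 hz hwz ▸ hw.1

/-- Two points of `Y` are adjacent if they are the two ends of a lift. -/
def Adj (q : Y → Λ.Real) (y z : Y) : Prop :=
  ∃ p : Λ.BoxLift q, (p.map (vec (Λ.deg p.mor)) = y ∧ p.map 0 = z) ∨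
    (p.map (vec (Λ.deg p.mor)) = z ∧ p.map 0 = y)

theorem adj_symm {y z : Y} (h : Adj q y z) : Adj q z y :=
  h.imp fun _ => Or.symm

theorem adj_map_vec (p : Λ.BoxLift q) {n : Fin k → ℕ} (hn : n ≤ Λ.deg p.mor) :
    Adj q (p.map 0) (p.map (vec n)) := by
  obtain ⟨x, y, rfl, -, hxy, e⟩ := Λ.exists_factor p.mor hn
  refine ⟨p.middle (x := Λ.rng x) (b := x) (y := y)
    (by rw [e, ← Λ.rng_comp _ _ hxy, Λ.id_comp]) (Λ.src_rng _) hxy, Or.inr ?_⟩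
  simp [middle, Λ.deg_rng]

open Relation in
/-- If `Y` is connected, any two starting points of lifts are joined by a chain of lifts. -/
theorem reflTransGen_adj [ConnectedSpace Y] (hq : IsCoveringMap q) (p r : Λ.BoxLift q) :
    ReflTransGen (Adj q) (p.map 0) (r.map 0) := by
  let W : Set Y := {y | ReflTransGen (Adj q) (p.map 0) y}
  have hW : ∀ (r : Λ.BoxLift q) {n : Fin k → ℕ}, n ≤ Λ.deg r.mor →
      (r.map 0 ∈ W ↔ r.map (vec n) ∈ W) := fun r n hn =>
    ⟨fun h => h.tail (r.adj_map_vec hn), fun h => h.tail (adj_symm (r.adj_map_vec hn))⟩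
  let U : Set Y := {y | ∃ (r : Λ.BoxLift q) (s : Fin k → ℝ), r.map s = y ∧ r.map 0 ∈ W}
  have hU : ∀ (r : Λ.BoxLift q) (t : Fin k → ℝ), r.map t ∈ U ↔ r.map 0 ∈ W := by
    refine fun r t => ⟨?_, fun h => ⟨r, t, rfl, h⟩⟩
    rintro ⟨r', s, e, h⟩
    rw [← r'.map_clamp hq, ← r.map_clamp hq] at e
    have hs := clamp_mem (Λ.deg r'.mor) s
    have ht := clamp_mem (Λ.deg r.mor) t
    have := map_fl_eq hq hs ht e
    rw [hW r ((fl_le_ce _).trans (ce_le fun i => (ht i).2)), ← this,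
      ← hW r' ((fl_le_ce _).trans (ce_le fun i => (hs i).2))]
    exact h
  have hclopen : IsClopen U := by
    refine ⟨⟨isOpen_of_isOpen_preimage_map hq fun r => ?_⟩,
      isOpen_of_isOpen_preimage_map hq fun r => ?_⟩
    · have : r.map ⁻¹' Uᶜ = {_t | r.map 0 ∉ W} := by ext t; simp [hU]
      rw [this]
      exact isOpen_const
    · have : r.map ⁻¹' U = {_t | r.map 0 ∈ W} := by ext t; simp [hU]
      rw [this]
      exact isOpen_const
  have huniv : U = Set.univ := hclopen.eq_univ ⟨p.map 0, (hU p 0).2 ReflTransGen.refl⟩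
  exact (hU r 0).1 (huniv ▸ Set.mem_univ _)

open Relation in
theorem countable_reflTransGen {α : Type*} {R : α → α → Prop} (hR : ∀ x, {y | R x y}.Countable)
    (x : α) : {y | ReflTransGen R x y}.Countable := by
  let S : ℕ → Set α := fun n => Nat.rec {x} (fun _ T => ⋃ z ∈ T, {y | R z y}) n
  have hS : ∀ n, (S n).Countable := by
    intro n
    induction n with
    | zero => exact Set.countable_singleton x
    | succ n ih => exact ih.biUnion fun z _ => hR z
  refine (Set.countable_iUnion hS).mono fun y hy => ?_
  induction hy with
  | refl => exact Set.mem_iUnion.2 ⟨0, rfl⟩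
  | tail _ h ih =>
    obtain ⟨n, hn⟩ := Set.mem_iUnion.1 ih
    exact Set.mem_iUnion.2 ⟨n + 1, Set.mem_biUnion hn h⟩

theorem countable_adj (hq : IsCoveringMap q) (y : Y) : {z | Adj q y z}.Countable := by
  have := Λ.countable
  have hcount : ∀ s t : Λ.Mor → Fin k → ℝ,
      {z | ∃ p : Λ.BoxLift q, p.map (s p.mor) = y ∧ p.map (t p.mor) = z}.Countable := by
    intro s t
    refine (Set.countable_iUnion (ι := Λ.Mor) (t := fun a =>
      {z | ∃ p : Λ.BoxLift q, p.mor = a ∧ p.map (s a) = y ∧ p.map (t a) = z})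
        fun a => Set.Subsingleton.countable ?_).mono ?_
    · rintro _ ⟨p, rfl, hp, rfl⟩ _ ⟨r, hr, hr', rfl⟩
      rw [ext_of_apply hq hr (s p.mor) (hr'.trans hp.symm)]
    · rintro z ⟨p, hp⟩
      exact Set.mem_iUnion.2 ⟨p.mor, p, rfl, hp⟩
  refine ((hcount (fun a => vec (Λ.deg a)) fun _ => 0).union
    (hcount (fun _ => 0) fun a => vec (Λ.deg a))).mono ?_
  rintro z ⟨p, hp | hp⟩
  · exact Or.inl ⟨p, hp⟩
  · exact Or.inr ⟨p, hp.2, hp.1⟩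

theorem countable [ConnectedSpace Y] (hq : IsCoveringMap q) : Countable (Λ.BoxLift q) := by
  have := Λ.countable
  rcases isEmpty_or_nonempty (Λ.BoxLift q) with _ | ⟨⟨p⟩⟩
  · infer_instance
  have := (countable_reflTransGen (countable_adj hq) (p.map 0)).to_subtype
  refine Function.Injective.countable (β := Λ.Mor × {y | Relation.ReflTransGen (Adj q) (p.map 0) y})
    (f := fun r => (r.mor, ⟨r.map 0, reflTransGen_adj hq p r⟩)) fun r s h => ?_
  simp only [Prod.mk.injEq, Subtype.mk.injEq] at h
  exact ext_of_apply hq h.1 0 h.2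

end BoxLift

end Lifts

section Cover

variable {Λ : KGraph k} {Y : Type} [TopologicalSpace Y] [ConnectedSpace Y] {q : Y → Λ.Real}

open BoxLift

/-- The `k`-graph whose morphisms are the lifts of the characteristic maps of `Λ`. -/
noncomputable def cover (hq : IsCoveringMap q) : KGraph k where
  Mor := Λ.BoxLift q
  countable := BoxLift.countable hq
  src := BoxLift.src
  rng := BoxLift.rng
  comp := BoxLift.comp hq
  deg p := Λ.deg p.mor
  src_src p := ext_of_apply hq (Λ.src_src _) 0 rfl
  rng_src p := ext_of_apply hq (Λ.rng_src _) 0 rfl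
  src_rng p := ext_of_apply hq (Λ.src_rng _) 0 rfl
  rng_rng p := ext_of_apply hq (Λ.rng_rng _) 0 rfl
  deg_src p := Λ.deg_src _
  deg_rng p := Λ.deg_rng _
  src_comp p r h := by
    have hm := (src_eq_rng_iff.1 h).1
    refine ext_of_apply hq ?_ 0 ?_
    · exact (congrArg Λ.src (comp_mor hq h)).trans (Λ.src_comp _ _ hm)
    · have := comp_map_right hq h (vec (Λ.deg r.mor))
      rw [clamp_vec, ← vec_add, ← Λ.deg_comp _ _ hm, ← comp_mor hq h] at this
      exact this
  rng_comp p r h := by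
    refine ext_of_apply hq ?_ 0 (comp_map_zero hq p r)
    exact (congrArg Λ.rng (comp_mor hq h)).trans (Λ.rng_comp _ _ (src_eq_rng_iff.1 h).1)
  comp_assoc p r s h h' := by
    have hm := (src_eq_rng_iff.1 h).1
    have hm' := (src_eq_rng_iff.1 h').1
    have h₁ : (BoxLift.comp hq p r).src = s.rng := by
      refine src_eq_rng_iff.2 ⟨?_, ?_⟩
      · rw [comp_mor hq h, Λ.src_comp _ _ hm, hm']
      · have := comp_map_right hq h (vec (Λ.deg r.mor))
        rw [clamp_vec, ← vec_add, ← Λ.deg_comp _ _ hm, ← comp_mor hq h] at this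
        rw [this, (src_eq_rng_iff.1 h').2]
    have h₂ : p.src = (BoxLift.comp hq r s).rng := by
      refine src_eq_rng_iff.2 ⟨?_, ?_⟩
      · rw [comp_mor hq h', Λ.rng_comp _ _ hm', hm]
      · rw [comp_map_zero, (src_eq_rng_iff.1 h).2]
    refine ext_of_apply hq ?_ 0 (by simp only [comp_map_zero])
    rw [comp_mor hq h₁, comp_mor hq h₂, comp_mor hq h, comp_mor hq h',
      Λ.comp_assoc _ _ _ hm hm']
  id_comp p := by
    refine ext_of_apply hq ?_ 0 (comp_map_zero hq _ _)
    rw [comp_mor hq (src_eq_rng_iff.2 ⟨Λ.src_rng _, rfl⟩)]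
    exact Λ.id_comp _
  comp_id p := by
    refine ext_of_apply hq ?_ 0 (comp_map_zero hq _ _)
    rw [comp_mor hq (src_eq_rng_iff.2 ⟨(Λ.rng_src _).symm, rfl⟩)]
    exact Λ.comp_id _
  deg_comp p r h := by
    rw [comp_mor hq h]
    exact Λ.deg_comp _ _ (src_eq_rng_iff.1 h).1
  factor p m n h := by
    obtain ⟨⟨a, b⟩, ⟨ha, hb, hab, e⟩, -⟩ := Λ.factor p.mor m n h
    dsimp only at ha hb hab e
    obtain ⟨x, rfl, hx⟩ := exists_apply_eq hq a 0 (p.map 0) (by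
      have := Λ.boxMap_comp_left hab 0
      rw [clamp_apply_zero, e] at this
      rw [p.apply_map, this])
    obtain ⟨y, rfl, hy⟩ := exists_apply_eq hq b 0 (x.map (vec (Λ.deg x.mor))) (by
      rw [x.apply_map, ← Λ.boxMap_src _ 0, hab, Λ.boxMap_rng])
    have hxy : x.src = y.rng := src_eq_rng_iff.2 ⟨hab, hy.symm⟩
    refine ⟨(x, y), ⟨ha, hb, hxy, ext_of_apply hq ((comp_mor hq hxy).trans e) 0
      ((comp_map_zero hq _ _).trans hx)⟩, ?_⟩
    rintro ⟨x', y'⟩ ⟨hx', hy', hxy', rfl⟩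
    dsimp only at hx' hy' hxy'
    obtain ⟨ex, ey⟩ := Λ.comp_left_cancel (src_eq_rng_iff.1 hxy').1 hab (hx'.trans ha.symm)
      ((comp_mor hq hxy').symm.trans e.symm)
    have hxx : x' = x := ext_of_apply hq ex 0 (by rw [hx, comp_map_zero])
    have hyy : y' = y := ext_of_apply hq ey 0 (by
      rw [hy, ← (src_eq_rng_iff.1 hxy').2, hxx])
    rw [hxx, hyy]

/-- The projection of `cover hq` onto `Λ`. -/
noncomputable def coverHom (hq : IsCoveringMap q) : KGraphHom (cover hq) Λ where
  toFun p := BoxLift.mor p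
  map_src _ := rfl
  map_rng _ := rfl
  map_comp _ _ h := comp_mor hq h
  map_deg _ := rfl

theorem exists_apply_eq_boxMap_vertex (hq : IsCoveringMap q) (hΛ : Λ.Connected) (v : Λ.Mor)
    (hv : Λ.deg v = 0) :
    ∃ y, q y = Λ.boxMap v 0 := by
  obtain ⟨y⟩ : Nonempty Y := inferInstance
  obtain ⟨a, t, -, e⟩ := Λ.exists_boxMap_eq (q y)
  obtain ⟨p, rfl, -⟩ := exists_apply_eq hq a t y e.symm
  induction hΛ (Λ.rng p.mor) v (Λ.deg_rng _) hv with
  | refl => exact ⟨p.map 0, by rw [p.apply_map, Λ.boxMap_rng]⟩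
  | tail _ h ih =>
    obtain ⟨c, ⟨rfl, rfl⟩ | ⟨rfl, rfl⟩⟩ := h
    · obtain ⟨z, hz⟩ := ih (Λ.deg_src _)
      obtain ⟨r, rfl, -⟩ := exists_apply_eq hq c (vec (Λ.deg c)) z (by rw [hz, Λ.boxMap_src])
      exact ⟨r.map 0, by rw [r.apply_map, Λ.boxMap_rng]⟩
    · obtain ⟨z, hz⟩ := ih (Λ.deg_rng _)
      obtain ⟨r, rfl, -⟩ := exists_apply_eq hq c 0 z (by rw [hz, Λ.boxMap_rng])
      exact ⟨r.map (vec (Λ.deg r.mor)), by rw [r.apply_map, Λ.boxMap_src]⟩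

theorem isCovering_coverHom (hq : IsCoveringMap q) (hΛ : Λ.Connected) :
    (coverHom hq).IsCovering := by
  refine ⟨fun a => ?_, fun (v : Λ.BoxLift q) (hv : Λ.deg v.mor = 0) => ⟨⟨?_, ?_, ?_⟩, ?_, ?_, ?_⟩⟩
  · obtain ⟨y, hy⟩ := exists_apply_eq_boxMap_vertex hq hΛ (Λ.rng a) (Λ.deg_rng a)
    obtain ⟨p, hp, -⟩ := exists_apply_eq hq a 0 y (by rw [hy, Λ.boxMap_rng])
    exact ⟨p, hp⟩
  · exact fun p hp => congrArg BoxLift.mor (show BoxLift.src p = v from hp)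
  · rintro p (hp : BoxLift.src p = v) r (hr : BoxLift.src r = v) (e : p.mor = r.mor)
    refine ext_of_apply hq e (vec (Λ.deg p.mor)) ?_
    have := congrArg (fun p : Λ.BoxLift q => p.map 0) (hp.trans hr.symm)
    exact this.trans (by rw [e]; rfl)
  · intro b (hb : Λ.src b = v.mor)
    obtain ⟨p, rfl, hp⟩ := exists_apply_eq hq b (vec (Λ.deg b)) (v.map 0) (by
      rw [v.apply_map, ← hb, Λ.boxMap_src])
    exact ⟨p, show p.src = v from ext_of_apply hq hb 0 hp, rfl⟩
  · exact fun p hp => congrArg BoxLift.mor (show BoxLift.rng p = v from hp)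
  · rintro p (hp : BoxLift.rng p = v) r (hr : BoxLift.rng r = v) (e : p.mor = r.mor)
    have := congrArg (fun p : Λ.BoxLift q => p.map 0) (hp.trans hr.symm)
    exact ext_of_apply hq e 0 this
  · intro b (hb : Λ.rng b = v.mor)
    obtain ⟨p, rfl, hp⟩ := exists_apply_eq hq b 0 (v.map 0) (by
      rw [v.apply_map, ← hb, Λ.boxMap_rng])
    exact ⟨p, show p.rng = v from ext_of_apply hq hb 0 hp, rfl⟩

theorem connected_cover (hq : IsCoveringMap q) : (cover hq).Connected := by
  intro (u : Λ.BoxLift q) (v : Λ.BoxLift q) (hu : Λ.deg u.mor = 0) (hv : Λ.deg v.mor = 0)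
  have vertex_ext : ∀ {v w : Λ.BoxLift q}, Λ.deg v.mor = 0 → Λ.deg w.mor = 0 →
      v.map 0 = w.map 0 → v = w := fun hv hw e => ext_of_apply hq
    (Λ.eq_of_boxMap_eq hv hw (by rw [← BoxLift.apply_map, ← BoxLift.apply_map, e])) 0 e
  obtain ⟨y, hy⟩ : ∃ y, v.map 0 = y := ⟨_, rfl⟩
  have hchain := reflTransGen_adj hq u v
  rw [hy] at hchain
  induction hchain generalizing v with
  | refl =>
    rw [vertex_ext hv hu hy]
    exact Relation.ReflTransGen.refl
  | tail _ h ih =>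
    obtain ⟨p, ⟨h₁, h₂⟩ | ⟨h₁, h₂⟩⟩ := h
    · refine (ih p.src (Λ.deg_src _) h₁).tail ⟨p, Or.inl ⟨rfl, ?_⟩⟩
      exact vertex_ext (Λ.deg_rng _) hv (h₂.trans hy.symm)
    · refine (ih p.rng (Λ.deg_rng _) h₂).tail ⟨p, Or.inr ⟨?_, rfl⟩⟩
      exact vertex_ext (Λ.deg_src _) hv (h₁.trans hy.symm)

theorem seg_cover (hq : IsCoveringMap q) (p : Λ.BoxLift q) {s : Fin k → ℝ}
    (hs : ∀ i, 0 ≤ s i ∧ s i ≤ (Λ.deg p.mor i : ℝ)) :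
    BoxLift.mor ((cover hq).seg p (fl s) (ce s)) = Λ.seg p.mor (fl s) (ce s) ∧
      BoxLift.map ((cover hq).seg p (fl s) (ce s)) (frac s) = p.map s := by
  obtain ⟨r, hr, hr₀, hr₁⟩ := p.exists_seg hs
  obtain ⟨hd, x, y, hx, hxb, hby, e⟩ := (cover hq).exists_seg_factor p (fl_le_ce s)
    (ce_le fun i => (hs i).2)
  generalize (cover hq).seg p (fl s) (ce s) = b at *
  change Λ.BoxLift q at x y b
  change BoxLift.src x = BoxLift.rng b at hxb
  change BoxLift.src b = BoxLift.rng y at hby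
  change Λ.deg x.mor = fl s at hx
  change Λ.deg b.mor = _ at hd
  have hxby : x.src = (BoxLift.comp hq b y).rng :=
    hxb.trans ((cover hq).rng_comp b y hby).symm
  have hmor : p.mor = Λ.comp x.mor (Λ.comp b.mor y.mor) := by
    rw [← comp_mor hq hby, ← comp_mor hq hxby]
    exact congrArg BoxLift.mor e
  have hb : b.mor = Λ.seg p.mor (fl s) (ce s) := by
    rw [hmor, ← hx]
    exact (Λ.seg_comp (src_eq_rng_iff.1 hxb).1 (src_eq_rng_iff.1 hby).1 (by rw [hd, hx])).symm
  have hbr : b = r := by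
    refine ext_of_apply hq (hb.trans hr.symm) 0 ?_
    have := comp_map_left hq hxby (vec (Λ.deg x.mor))
    rw [clamp_vec] at this
    rw [hr₀, ← (src_eq_rng_iff.1 hxb).2, ← this, hx]
    exact congrArg (fun p : Λ.BoxLift q => p.map (vec (fl s))) e.symm
  exact ⟨hb, by rw [hbr, hr₁]⟩

/-- The comparison map from the realization of `cover hq` to `Y`. -/
noncomputable def coverReal (hq : IsCoveringMap q) : (cover hq).Real → Y :=
  Quotient.lift (fun p : (cover hq).Points => BoxLift.map p.1 p.2.1) (by
    rintro ⟨p, s, hs⟩ ⟨r, t, ht⟩ ⟨h, h'⟩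
    dsimp only at h h' ⊢
    rw [← (seg_cover hq p hs).2, ← (seg_cover hq r ht).2, h, h'])

theorem continuous_coverReal (hq : IsCoveringMap q) : Continuous (coverReal hq) :=
  Continuous.quotient_lift (s := (cover hq).ptSetoid)
    (continuous_sigma fun p : Λ.BoxLift q => p.map.continuous.comp continuous_subtype_val) _

theorem bijective_coverReal (hq : IsCoveringMap q) : Function.Bijective (coverReal hq) := by
  constructor
  · intro z w
    induction z using Quotient.inductionOn with | h z =>
    induction w using Quotient.inductionOn with | h w =>
    obtain ⟨p, s, hs⟩ := z
    obtain ⟨r, t, ht⟩ := w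
    change Λ.BoxLift q at p r
    intro (e : p.map s = r.map t)
    have hm := (Λ.boxMap_eq_iff (a := p.mor) (b := r.mor) hs ht).1
      (by rw [← p.apply_map, ← r.apply_map, e])
    obtain ⟨hp, hp'⟩ := seg_cover hq p hs
    obtain ⟨hr, hr'⟩ := seg_cover hq r ht
    refine Quotient.sound (s := (cover hq).ptSetoid) ⟨?_, hm.2⟩
    exact ext_of_apply hq (by rw [hp, hr, hm.1]) (frac s) (by rw [hp', e, hm.2, hr'])
  · intro y
    obtain ⟨a, t, ht, e⟩ := Λ.exists_boxMap_eq (q y)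
    obtain ⟨p, rfl, rfl⟩ := exists_apply_eq hq a t y e.symm
    exact ⟨(cover hq).pt p t ht, rfl⟩

theorem isOpenMap_coverReal (hq : IsCoveringMap q) : IsOpenMap (coverReal hq) := by
  intro U hU
  refine isOpen_of_isOpen_preimage_map hq fun p => ?_
  convert hU.preimage ((cover hq).boxMap p).continuous using 1
  ext t
  have : p.map t = coverReal hq ((cover hq).boxMap p t) := (p.map_clamp hq t).symm
  rw [Set.mem_preimage, this, (bijective_coverReal hq).injective.mem_set_image]
  rfl

end Cover

end KGraph

/-- If `Λ` is a connected `k`-graph and `q : Y → X_Λ` is a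
topological covering map with `Y` connected, then there are a connected
`k`-graph `Ω`, a covering of `k`-graphs `p : Ω → Λ` and a homeomorphism
`φ : Y → X_Ω` with `q = p̃ ∘ φ`, where `p̃` is the induced map of topological
realizations (characterized by `p̃([ω,t]) = [p(ω),t]`). -/
theorem topological_cover_is_realization
    {k : ℕ} (Λ : KGraph k) (hΛ : Λ.Connected)
    (Y : Type) [TopologicalSpace Y] [ConnectedSpace Y]
    (q : C(Y, Λ.Real)) (hq : IsCoveringMap q) :
    ∃ (Ω : KGraph k) (p : KGraphHom Ω Λ),
      Ω.Connected ∧ p.IsCovering ∧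
      ∃ (F : C(Ω.Real, Λ.Real)) (φ : Y ≃ₜ Ω.Real),
        (∀ (a : Ω.Mor) (t : Fin k → ℝ)
          (hb : ∀ i, 0 ≤ t i ∧ t i ≤ (Ω.deg a i : ℝ))
          (hb' : ∀ i, 0 ≤ t i ∧ t i ≤ (Λ.deg (p.toFun a) i : ℝ)),
          F (Ω.pt a t hb) = Λ.pt (p.toFun a) t hb') ∧
        ∀ y : Y, q y = F (φ y) := by
  let ψ : (KGraph.cover hq).Real ≃ₜ Y :=
    (Equiv.ofBijective _ (KGraph.bijective_coverReal hq)).toHomeomorphOfContinuousOpen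
      (KGraph.continuous_coverReal hq) (KGraph.isOpenMap_coverReal hq)
  refine ⟨KGraph.cover hq, KGraph.coverHom hq, KGraph.connected_cover hq,
    KGraph.isCovering_coverHom hq hΛ, q.comp ⟨ψ, ψ.continuous⟩, ψ.symm, ?_, fun y => ?_⟩
  · intro a t hb hb'
    exact (KGraph.BoxLift.apply_map a t).trans (Λ.boxMap_eq_pt hb')
  · exact congrArg q (ψ.apply_symm_apply y).symm
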